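/- The amalgamated duplication 𝒜⋊𝔄 is semisimple (its Gelfand homomorphism into C₀(σ(𝒜⋊𝔄)) is injective) if and only if both 𝒜 and 𝔄 are semisimple. -/

import Mathlib

noncomputable section

open ContinuousLinearMap

/-- `𝒜` is a Banach `𝔄`-bimodule with compatible actions. -/
structure BiAction (A B : Type) [NonUnitalNormedRing A] [NormedSpace ℂ A]
    [IsScalarTower ℂ A A] [SMulCommClass ℂ A A]
    [NonUnitalNormedRing B] [NormedSpace ℂ B] [IsScalarTower ℂ B B] [SMulCommClass ℂ B B] :
    Type where
  l : B →L[ℂ] A →L[ℂ] A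
  r : A →L[ℂ] B →L[ℂ] A
  l_mul : ∀ (β γ : B) (a : A), l (β * γ) a = l β (l γ a)
  r_mul : ∀ (a : A) (β γ : B), r a (β * γ) = r (r a β) γ
  lr_assoc : ∀ (β : B) (a : A) (γ : B), r (l β a) γ = l β (r a γ)
  compat_l : ∀ (β : B) (a b : A), l β (a * b) = l β a * b
  compat_r : ∀ (a b : A) (β : B), r (a * b) β = a * r b β
  compat_m : ∀ (a : A) (β : B) (b : A), a * l β b = r a β * b

variable {A B : Type} [NonUnitalNormedCommRing A] [NormedSpace ℂ A]
    [IsScalarTower ℂ A A] [SMulCommClass ℂ A A]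
    [NonUnitalNormedCommRing B] [NormedSpace ℂ B] [IsScalarTower ℂ B B] [SMulCommClass ℂ B B]
    [CompleteSpace A] [CompleteSpace B]

/-- The multiplication of the amalgamated duplication `𝒜 ⋊ 𝔄`. -/
def dupMul (σ : BiAction A B) (x y : A × B) : A × B :=
  (x.1 * y.1 + σ.r x.1 y.2 + σ.l x.2 y.1, x.2 * y.2)

/-- Semisimplicity of a commutative Banach algebra: the Gelfand homomorphism is injective,
i.e. the characters separate the points from `0`. -/
def IsSemisimpleAlg (C : Type) [NonUnitalNormedRing C] [NormedSpace ℂ C] : Prop :=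
  ∀ c : C, (∀ φ : C →L[ℂ] ℂ, (φ ≠ 0 ∧ ∀ x y : C, φ (x * y) = φ x * φ y) → φ c = 0) → c = 0

/-- Semisimplicity of `𝒜 ⋊ 𝔄` (characters identified with pairs `(φ, ψ)` acting by
`(a, β) ↦ φ(a) + ψ(β)`). -/
def IsSemisimpleDup (σ : BiAction A B) : Prop :=
  ∀ x : A × B,
    (∀ p : (A →L[ℂ] ℂ) × (B →L[ℂ] ℂ),
      (p ≠ 0 ∧ ∀ y z : A × B,
        p.1 (dupMul σ y z).1 + p.2 (dupMul σ y z).2 =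
          (p.1 y.1 + p.2 y.2) * (p.1 z.1 + p.2 z.2)) →
      p.1 x.1 + p.2 x.2 = 0) → x = 0

/-- `(φ, ψ)` acts multiplicatively on `𝒜 ⋊ 𝔄` if `φ` and `ψ` are multiplicative and `φ` intertwines
the actions through `ψ`. -/
theorem dup_multiplicative_of (σ : BiAction A B) (hsym : ∀ (β : B) (a : A), σ.l β a = σ.r a β)
    (φ : A →L[ℂ] ℂ) (ψ : B →L[ℂ] ℂ) (hφ : ∀ a b, φ (a * b) = φ a * φ b)
    (hψ : ∀ β γ, ψ (β * γ) = ψ β * ψ γ) (h : ∀ β a, φ (σ.l β a) = ψ β * φ a) (y z : A × B) :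
    φ (dupMul σ y z).1 + ψ (dupMul σ y z).2 = (φ y.1 + ψ y.2) * (φ z.1 + ψ z.2) := by
  simp only [dupMul, map_add, ← hsym, hφ, hψ, h]
  ring

/-- A character `φ` of `𝒜` induces a multiplicative functional `β ↦ φ (β · e)` on `𝔄`, where
`φ e = 1`, through which it intertwines the action. -/
theorem exists_intertwining_functional (σ : BiAction A B) (φ : A →L[ℂ] ℂ) (hφ0 : φ ≠ 0)
    (hφ : ∀ a b, φ (a * b) = φ a * φ b) :
    ∃ ψ : B →L[ℂ] ℂ, (∀ β γ, ψ (β * γ) = ψ β * ψ γ) ∧ ∀ β a, φ (σ.l β a) = ψ β * φ a := by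
  obtain ⟨u, hu⟩ : ∃ u, φ u ≠ 0 := by
    by_contra! h
    exact hφ0 (ContinuousLinearMap.ext h)
  obtain ⟨e, he⟩ : ∃ e, φ e = 1 := ⟨(φ u)⁻¹ • u, by simp [hu]⟩
  have key (β : B) (a : A) : φ (σ.l β a) = φ (σ.l β e) * φ a := by
    rw [← hφ, ← σ.compat_l, mul_comm, σ.compat_l, hφ, he, mul_one]
  refine ⟨φ.comp (σ.l.flip e), fun β γ => ?_, key⟩
  simp only [comp_apply, flip_apply, σ.l_mul]
  exact key β _

/-- For commutative `𝒜`, `𝔄` with symmetric action, `𝒜 ⋊ 𝔄` is semisimple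
if and only if both `𝒜` and `𝔄` are semisimple. -/
theorem semisimple_dup_iff (σ : BiAction A B)
    (hsym : ∀ (β : B) (a : A), σ.l β a = σ.r a β) :
    IsSemisimpleDup σ ↔ IsSemisimpleAlg A ∧ IsSemisimpleAlg B := by
  constructor
  · intro h
    refine ⟨fun a ha => ?_, fun β hβ => ?_⟩
    · refine congrArg Prod.fst (h (a, 0) ?_)
      rintro ⟨φ, ψ⟩ ⟨-, hm⟩
      by_cases h0 : φ = 0
      · simp [h0]
      · have hφ := ha φ ⟨h0, fun x y => by simpa [dupMul] using hm (x, 0) (y, 0)⟩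
        simpa using hφ
    · refine congrArg Prod.snd (h (0, β) ?_)
      rintro ⟨φ, ψ⟩ ⟨-, hm⟩
      by_cases h0 : ψ = 0
      · simp [h0]
      · have hψ := hβ ψ ⟨h0, fun x y => by simpa [dupMul] using hm (0, x) (0, y)⟩
        simpa using hψ
  · rintro ⟨hA, hB⟩ ⟨a, β⟩ h
    obtain rfl : β = 0 := hB β fun ψ ⟨h0, hψ⟩ => by
      simpa using h (0, ψ) ⟨by simpa [Prod.ext_iff] using h0,
        dup_multiplicative_of σ hsym 0 ψ (by simp) hψ (by simp)⟩
    obtain rfl : a = 0 := hA a fun φ ⟨h0, hφ⟩ => by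
      obtain ⟨ψ, hψ, hi⟩ := exists_intertwining_functional σ φ h0 hφ
      simpa using h (φ, ψ) ⟨fun hp => h0 (congrArg Prod.fst hp),
        dup_multiplicative_of σ hsym φ ψ hφ hψ hi⟩
    rfl

end
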